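/- Let M ⊆ 𝓔¹⁴ be a primitive 𝓔-submodule of the Allcock lattice 𝕃^A which is of type p·L₃ ⊥ q·L₄ for some integers p, q ≥ 0 with p + q ≥ 1 (i.e., M is free of rank 3p + 4q over 𝓔 with a basis whose Gram matrix with respect to the hermitian form of 𝕃^A is block diagonal with p blocks G₃ followed by q blocks G₄). Then p + q ≤ 3. In particular, 𝕃^A contains no primitive sublattice of type 4·L₃ and none of type 3·L₃ ⊥ L₄. -/

import Mathlib

set_option synthInstance.maxHeartbeats 1000000
set_option maxHeartbeats 1000000

open Matrix

/-- `ω = (−1+√−3)/2`, a primitive cube root of unity in `ℂ`. -/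
noncomputable def ω : ℂ := (-1 + Complex.I * Real.sqrt 3) / 2

/-- `θ = ω − ω̄ = √−3`. -/
noncomputable def θ : ℂ := Complex.I * Real.sqrt 3

/-- The ring `𝓔 = ℤ[ω]` of Eisenstein integers, as a subring of `ℂ`. -/
def Eis : Subring ℂ := Subring.closure {ω}

/-- The Gram matrix `Gₙ` of the Eisenstein lattice `Lₙ`: diagonal entries `3`, entries
`θ` and `−θ` next to the diagonal, `0` elsewhere. -/
noncomputable def Gm (n : ℕ) : Matrix (Fin n) (Fin n) ℂ :=
  Matrix.of fun i j =>
    if i = j then 3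
    else if (i : ℕ) + 1 = (j : ℕ) then θ
    else if (j : ℕ) + 1 = (i : ℕ) then -θ
    else 0

/-- The Gram matrix of the hyperbolic Eisenstein lattice `𝓗`. -/
noncomputable def GH : Matrix (Fin 2) (Fin 2) ℂ := !![0, θ; -θ, 0]

/-- A matrix has all its entries in `𝓔`. -/
def EisEntries {m n : Type*} (U : Matrix m n ℂ) : Prop := ∀ i j, U i j ∈ Eis

/-- A (possibly rectangular) matrix is invertible over `𝓔`: it has a two-sided inverse
with entries in `𝓔`. -/
def EisInvertible {m n : Type*} [Fintype m] [Fintype n] [DecidableEq m] [DecidableEq n]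
    (U : Matrix m n ℂ) : Prop :=
  EisEntries U ∧ ∃ W : Matrix n m ℂ, EisEntries W ∧ U * W = 1 ∧ W * U = 1

/-- The index type of the Allcock lattice `𝕃^A = 𝓔¹⁴` (of type `3L₄ ⊥ 𝓗`). -/
abbrev IA : Type := Fin 4 ⊕ (Fin 4 ⊕ (Fin 4 ⊕ Fin 2))

/-- The Gram matrix `G_A = diag(G₄, G₄, G₄, G_H)` of the Allcock lattice. -/
noncomputable def GA : Matrix IA IA ℂ :=
  Matrix.fromBlocks (Gm 4) 0 0
    (Matrix.fromBlocks (Gm 4) 0 0 (Matrix.fromBlocks (Gm 4) 0 0 GH))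

/-- The hermitian form `h(x,y) = x̄ᵀ G_A y` of the Allcock lattice on `𝓔¹⁴`. -/
noncomputable def hA (x y : IA → ↥Eis) : ℂ :=
  ∑ i, ∑ j, (starRingEnd ℂ) (x i : ℂ) * GA i j * (y j : ℂ)

/-- The block-diagonal Gram matrix of `p·L₃ ⊥ q·L₄` (with `p` blocks `G₃` followed by
`q` blocks `G₄`). -/
noncomputable def GramPQ (p q : ℕ) :
    ((Fin p × Fin 3) ⊕ (Fin q × Fin 4)) → ((Fin p × Fin 3) ⊕ (Fin q × Fin 4)) → ℂ
  | Sum.inl (s, k), Sum.inl (s', k') => if s = s' then Gm 3 k k' else 0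
  | Sum.inl _, Sum.inr _ => 0
  | Sum.inr _, Sum.inl _ => 0
  | Sum.inr (s, k), Sum.inr (s', k') => if s = s' then Gm 4 k k' else 0

theorem theta_sq : θ * θ = -3 := by
  have h3 : ((Real.sqrt 3 : ℝ) : ℂ) * (Real.sqrt 3 : ℝ) = 3 := by
    rw [← Complex.ofReal_mul, Real.mul_self_sqrt (by norm_num)]; norm_num
  calc θ * θ = (Complex.I * Complex.I) * (((Real.sqrt 3 : ℝ) : ℂ) * (Real.sqrt 3 : ℝ)) := by
        unfold θ; ring
    _ = -3 := by rw [h3, Complex.I_mul_I]; ring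

theorem theta_ne_zero : θ ≠ 0 := by
  intro h
  have := theta_sq
  norm_num [h] at this

theorem omega_eq : ω = (-1 + θ) / 2 := rfl

theorem theta_eq : θ = 1 + 2 * ω := by rw [omega_eq]; ring

theorem conj_theta : (starRingEnd ℂ) θ = -θ := by simp [θ]

theorem omega_mem : ω ∈ Eis := Subring.subset_closure rfl

theorem theta_mem : θ ∈ Eis := by
  rw [theta_eq]
  exact add_mem (one_mem _) (mul_mem (by exact_mod_cast natCast_mem Eis 2) omega_mem)

/-- `θ` as an element of `𝓔`. -/
noncomputable def thetaEis : Eis := ⟨θ, theta_mem⟩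

theorem thetaEis_ne_zero : thetaEis ≠ 0 := fun h => theta_ne_zero (congrArg Subtype.val h)

theorem exists_int_add_int_mul_omega {z : ℂ} (hz : z ∈ Eis) :
    ∃ a b : ℤ, z = a + b * ω := by
  have hω : ω * ω = -1 - ω := by
    rw [omega_eq]; linear_combination (1 / 4 : ℂ) * theta_sq
  induction hz using Subring.closure_induction with
  | mem x hx => exact ⟨0, 1, by simpa using hx⟩
  | zero => exact ⟨0, 0, by simp⟩
  | one => exact ⟨1, 0, by simp⟩
  | add x y _ _ hx hy =>
    obtain ⟨a, b, rfl⟩ := hx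
    obtain ⟨c, d, rfl⟩ := hy
    exact ⟨a + c, b + d, by push_cast; ring⟩
  | neg x _ hx =>
    obtain ⟨a, b, rfl⟩ := hx
    exact ⟨-a, -b, by push_cast; ring⟩
  | mul x y _ _ hx hy =>
    obtain ⟨a, b, rfl⟩ := hx
    obtain ⟨c, d, rfl⟩ := hy
    exact ⟨a * c - b * d, a * d + b * c - b * d, by
      push_cast; linear_combination (b * d : ℂ) * hω⟩

theorem exists_conj_eq_add_theta_mul (e : Eis) :
    ∃ d : Eis, (starRingEnd ℂ) (e : ℂ) = ((e + thetaEis * d : Eis) : ℂ) := by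
  obtain ⟨a, b, h⟩ := exists_int_add_int_mul_omega e.2
  refine ⟨-(b : Eis), ?_⟩
  have hω : (starRingEnd ℂ) ω = ω - θ := by
    simp only [omega_eq, map_div₀, map_add, map_neg, map_one, conj_theta, map_ofNat]
    ring
  simp [thetaEis, h, hω]
  ring

theorem exists_eq_int_add_theta_mul (e : Eis) :
    ∃ (n : ℤ) (d : Eis), e = n + thetaEis * d := by
  obtain ⟨a, b, h⟩ := exists_int_add_int_mul_omega e.2
  refine ⟨a + b, b * (1 + ⟨ω, omega_mem⟩), Subtype.ext ?_⟩
  simp only [thetaEis, h, omega_eq, Subring.coe_add, Subring.coe_mul, Subring.coe_intCast,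
    Subring.coe_one, Int.cast_add]
  linear_combination (-(b : ℂ) / 2) * theta_sq

theorem three_eq : (3 : Eis) = -(thetaEis * thetaEis) := by
  refine Subtype.ext ?_
  have h := theta_sq
  change (3 : ℂ) = -(θ * θ)
  linear_combination h

theorem thetaEis_not_isUnit : ¬ IsUnit thetaEis := by
  intro h
  obtain ⟨e, he⟩ := h.exists_right_inv
  obtain ⟨a, b, hab⟩ := exists_int_add_int_mul_omega e.2
  have h1 : θ * (e : ℂ) = 1 := congrArg Subtype.val he
  rw [hab, omega_eq] at h1
  have h2 : ((2 * a - b : ℤ) : ℂ) * θ = ((2 + 3 * b : ℤ) : ℂ) := by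
    push_cast; linear_combination 2 * h1 - (b : ℂ) * theta_sq
  have hre := congrArg Complex.re h2
  rw [← Complex.ofReal_intCast, Complex.re_ofReal_mul, Complex.intCast_re] at hre
  have h0 : (2 + 3 * b : ℤ) = 0 := by
    exact_mod_cast (by simpa [θ] using hre.symm : ((2 + 3 * b : ℤ) : ℝ) = 0)
  omega

/-- The ideal `θ𝓔`. -/
noncomputable abbrev thetaIdeal : Ideal Eis := Ideal.span {thetaEis}

instance thetaIdeal_isMaximal : thetaIdeal.IsMaximal := by
  rw [Ideal.isMaximal_iff]
  refine ⟨fun h => thetaEis_not_isUnit ?_, fun J x hJ hx hxJ => ?_⟩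
  · exact isUnit_of_dvd_one (Ideal.mem_span_singleton.1 h)
  · obtain ⟨n, d, rfl⟩ := exists_eq_int_add_theta_mul x
    have hθ : thetaEis ∈ J := hJ (Ideal.mem_span_singleton_self _)
    have hn : (n : Eis) ∈ J := (J.add_mem_iff_left (J.mul_mem_right _ hθ)).1 hxJ
    have h3 : (3 : Eis) ∈ J := by
      rw [three_eq]; exact J.neg_mem (J.mul_mem_right _ hθ)
    have hn3 : ¬ (3 : ℤ) ∣ n := by
      rintro ⟨m, rfl⟩
      refine hx (Ideal.mem_span_singleton.2 ⟨-(thetaEis * m) + d, ?_⟩)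
      push_cast
      rw [three_eq]; ring
    have hcop : IsCoprime (3 : ℤ) n := (Int.prime_three.coprime_iff_not_dvd).2 hn3
    obtain ⟨u, v, huv⟩ := hcop
    have h1 : (1 : Eis) = u * 3 + v * n := by exact_mod_cast congrArg (Int.cast (R := Eis)) huv.symm
    rw [h1]
    exact J.add_mem (J.mul_mem_left _ h3) (J.mul_mem_left _ hn)

/-- The residue field `𝓔/θ𝓔`. -/
abbrev EisResidue : Type := Eis ⧸ thetaIdeal

noncomputable instance : Field EisResidue := Ideal.Quotient.field thetaIdeal

/-- The reduction map `𝓔 → 𝓔/θ𝓔`. -/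
noncomputable abbrev eisRed : Eis →+* EisResidue := Ideal.Quotient.mk thetaIdeal

theorem eisRed_eq_zero_iff {e : Eis} : eisRed e = 0 ↔ thetaEis ∣ e := by
  rw [Ideal.Quotient.eq_zero_iff_mem, Ideal.mem_span_singleton]

theorem eisRed_theta_mul (e : Eis) : eisRed (thetaEis * e) = 0 :=
  eisRed_eq_zero_iff.2 ⟨e, rfl⟩

/-- The integral symplectic matrix congruent to `θ⁻¹ G₄` modulo `θ`. -/
def symplL4 : Matrix (Fin 4) (Fin 4) ℤ :=
  !![0, 1, 0, 0; -1, 0, 1, 0; 0, -1, 0, 1; 0, 0, -1, 0]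

/-- The integral symplectic matrix `θ⁻¹ G_H`. -/
def symplH : Matrix (Fin 2) (Fin 2) ℤ := !![0, 1; -1, 0]

/-- The integral symplectic matrix congruent to `θ⁻¹ G_A` modulo `θ`. -/
def symplA : Matrix IA IA ℤ :=
  Matrix.fromBlocks symplL4 0 0
    (Matrix.fromBlocks symplL4 0 0 (Matrix.fromBlocks symplL4 0 0 symplH))

theorem det_symplA : symplA.det = 1 := by
  have h4 : symplL4.det = 1 := by decide
  have h2 : symplH.det = 1 := by decide
  simp [symplA, h4, h2]

theorem exists_GA_eq (i j : IA) :
    ∃ e : Eis, GA i j = θ * ((symplA i j + thetaEis * e : Eis) : ℂ) := by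
  have h4 (k l : Fin 4) :
      ∃ e : Eis, Gm 4 k l = θ * ((symplL4 k l + thetaEis * e : Eis) : ℂ) := by
    by_cases hkl : k = l
    · subst hkl
      refine ⟨-1, ?_⟩
      have h0 : symplL4 k k = 0 := by revert k; decide
      simp [Gm, h0, thetaEis, theta_sq]
    · refine ⟨0, ?_⟩
      fin_cases k <;> fin_cases l <;> simp [Gm, symplL4] at hkl ⊢
  have hH (k l : Fin 2) :
      ∃ e : Eis, GH k l = θ * ((symplH k l + thetaEis * e : Eis) : ℂ) :=
    ⟨0, by fin_cases k <;> fin_cases l <;> simp [GH, symplH]⟩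
  rcases i with i | i | i | i <;> rcases j with j | j | j | j <;>
    first
    | exact h4 i j
    | exact hH i j
    | exact ⟨0, by simp [GA, symplA]⟩

/-- The reduction modulo `θ` of the form `θ⁻¹ h` of the Allcock lattice. -/
noncomputable def redForm : LinearMap.BilinForm EisResidue (IA → EisResidue) :=
  Matrix.toBilin' (symplA.map (Int.cast : ℤ → EisResidue))

theorem redForm_apply (x y : IA → EisResidue) :
    redForm x y = ∑ i, ∑ j, x i * (symplA i j : EisResidue) * y j := by
  simp [redForm, Matrix.toBilin'_apply]

theorem redForm_nondegenerate : redForm.Nondegenerate := by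
  refine LinearMap.BilinForm.nondegenerate_toBilin'_of_det_ne_zero' _ ?_
  have h := (Int.castRingHom EisResidue).map_det symplA
  rw [det_symplA] at h
  have h' : (symplA.map (Int.cast : ℤ → EisResidue)).det = 1 := by
    simpa [RingHom.mapMatrix_apply] using h.symm
  rw [h']
  exact one_ne_zero

theorem exists_hA_eq (x y : IA → Eis) :
    ∃ e : Eis, hA x y = θ * (e : ℂ) ∧ eisRed e = redForm (eisRed ∘ x) (eisRed ∘ y) := by
  choose c hc using fun i => exists_conj_eq_add_theta_mul (x i)
  choose g hg using exists_GA_eq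
  refine ⟨∑ i, ∑ j, (x i + thetaEis * c i) * (symplA i j + thetaEis * g i j) * y j, ?_, ?_⟩
  · unfold hA
    push_cast
    simp only [Finset.mul_sum]
    refine Finset.sum_congr rfl fun i _ => Finset.sum_congr rfl fun j _ => ?_
    rw [hc, hg]
    push_cast
    ring
  · rw [redForm_apply]
    simp only [map_sum, map_mul, map_add, map_intCast, Function.comp_apply,
      eisRed_eq_zero_iff.2 (dvd_refl thetaEis), zero_mul, add_zero]

/-- A basis of a primitive submodule stays linearly independent modulo `θ`. -/
theorem linearIndependent_red {ι κ : Type*} [Fintype ι] (M : Submodule Eis (κ → Eis))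
    (hprim : ∀ (x : κ → Eis) (c : Eis), c ≠ 0 → c • x ∈ M → x ∈ M)
    (b : ι → κ → Eis) (hli : LinearIndependent Eis b)
    (hspan : Submodule.span Eis (Set.range b) = M) :
    LinearIndependent EisResidue fun i => eisRed ∘ b i := by
  rw [Fintype.linearIndependent_iff]
  intro c hc
  choose d hd using fun i => Ideal.Quotient.mk_surjective (I := thetaIdeal) (c i)
  have hdvd (k : κ) : thetaEis ∣ (∑ i, d i • b i) k := by
    rw [← eisRed_eq_zero_iff]
    have := congrFun hc k
    simpa [Finset.sum_apply, hd] using this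
  choose x hx using hdvd
  have hx' : ∑ i, d i • b i = thetaEis • x := funext hx
  have hxM : x ∈ M := by
    refine hprim x thetaEis thetaEis_ne_zero ?_
    rw [← hx', ← hspan]
    exact Submodule.sum_mem _ fun i _ =>
      Submodule.smul_mem _ _ (Submodule.subset_span ⟨i, rfl⟩)
  rw [← hspan, Submodule.mem_span_range_iff_exists_fun] at hxM
  obtain ⟨f, hf⟩ := hxM
  have h0 : ∑ i, (d i - thetaEis * f i) • b i = 0 := by
    simp only [sub_smul, mul_smul, Finset.sum_sub_distrib, ← Finset.smul_sum]
    rw [hx', hf, sub_self]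
  intro i
  have hi := Fintype.linearIndependent_iff.1 hli _ h0 i
  rw [← hd i, sub_eq_zero.1 hi]
  exact eisRed_theta_mul _

theorem GramPQ_add_mem (p q : ℕ) (s : Fin p) (j : (Fin p × Fin 3) ⊕ (Fin q × Fin 4)) :
    ∃ a : Eis, GramPQ p q (Sum.inl (s, 0)) j + GramPQ p q (Sum.inl (s, 2)) j =
      θ * ((thetaEis * a : Eis) : ℂ) := by
  rcases j with ⟨t, k⟩ | ⟨t, k⟩
  · by_cases hst : s = t
    · fin_cases k
      · exact ⟨-1, by simp [GramPQ, hst, Gm, thetaEis, theta_sq]⟩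
      · exact ⟨0, by simp [GramPQ, hst, Gm]⟩
      · exact ⟨-1, by simp [GramPQ, hst, Gm, thetaEis, theta_sq]⟩
    · exact ⟨0, by simp [GramPQ, hst]⟩
  · exact ⟨0, by simp [GramPQ]⟩

/-- Statement 18: if a primitive `𝓔`-submodule `M` of the Allcock lattice `𝕃^A` is of
type `p·L₃ ⊥ q·L₄` (it is free with a basis whose Gram matrix is the block-diagonal
matrix with `p` blocks `G₃` and `q` blocks `G₄`), then `p + q ≤ 3`. -/
theorem statement18 (M : Submodule ↥Eis (IA → ↥Eis))
    (hprim : ∀ (x : IA → ↥Eis) (c : ↥Eis), c ≠ 0 → c • x ∈ M → x ∈ M)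
    (p q : ℕ) (hpq : 1 ≤ p + q)
    (b : ((Fin p × Fin 3) ⊕ (Fin q × Fin 4)) → (IA → ↥Eis))
    (hmem : ∀ i, b i ∈ M)
    (hli : LinearIndependent ↥Eis b)
    (hspan : Submodule.span ↥Eis (Set.range b) = M)
    (hgram : ∀ i j, hA (b i) (b j) = GramPQ p q i j) :
    p + q ≤ 3 := by
  set v := fun i => eisRed ∘ b i with hv
  have hvli : LinearIndependent EisResidue v := linearIndependent_red M hprim b hli hspan
  set w : Fin p → IA → EisResidue := fun s => v (Sum.inl (s, 0)) + v (Sum.inl (s, 2)) with hw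
  have hwli : LinearIndependent EisResidue w := by
    rw [Fintype.linearIndependent_iff] at hvli ⊢
    intro c hc s
    have := hvli (Sum.elim (fun i => if i.2 = 1 then 0 else c i.1) 0) (by
      simpa [Fintype.sum_prod_type, Fin.sum_univ_three, hw, smul_add] using hc) (Sum.inl (s, 0))
    simpa using this
  have horth (s : Fin p) (j) : redForm (w s) (v j) = 0 := by
    obtain ⟨e, he, he'⟩ := exists_hA_eq (b (Sum.inl (s, 0))) (b j)
    obtain ⟨f, hf, hf'⟩ := exists_hA_eq (b (Sum.inl (s, 2))) (b j)
    obtain ⟨a, ha⟩ := GramPQ_add_mem p q s j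
    rw [← hgram, ← hgram, he, hf, ← mul_add] at ha
    have hef : e + f = thetaEis * a := Subtype.ext (mul_left_cancel₀ theta_ne_zero ha)
    rw [hw, LinearMap.BilinForm.add_left, hv, ← he', ← hf', ← map_add, hef, eisRed_theta_mul]
  set W := Submodule.span EisResidue (Set.range w) with hW
  set V := Submodule.span EisResidue (Set.range v) with hV
  have hVW : V ≤ redForm.orthogonal W := by
    rw [hV, Submodule.span_le]
    rintro _ ⟨j, rfl⟩
    have hker : W ≤ LinearMap.ker (redForm.flip (v j)) := by
      rw [hW, Submodule.span_le]
      rintro _ ⟨s, rfl⟩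
      exact horth s j
    exact fun x hx => hker hx
  have hWrank : Module.finrank EisResidue W = p := by
    rw [hW, finrank_span_eq_card hwli, Fintype.card_fin]
  have hVrank : Module.finrank EisResidue V = p * 3 + q * 4 := by
    rw [hV, finrank_span_eq_card hvli]
    simp
  have hle := Submodule.finrank_mono hVW
  have hWle := Submodule.finrank_le W
  rw [LinearMap.BilinForm.finrank_orthogonal redForm_nondegenerate] at hle
  have hdim : Module.finrank EisResidue (IA → EisResidue) = 14 := by simp
  omega
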